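/- Assume σ > -2 and p < -1-σ, and set a = (2+σ)/(1-p) ∈ (0,1). Then there is no positive C² solution u of -u''(x) = x^σ u(x)^p on (0,+∞) satisfying u(x) < u_a(x) for all x > 0; that is, no global positive solution stays strictly below the explicit solution u_a. -/

import Mathlib

open Set

/-- The explicit solution `u_a(x) = c_a x^a` with `a = (2+σ)/(1-p)` and
`c_a = (a(1-a))^{1/(p-1)}`. -/
noncomputable def uExplicit (p σ : ℝ) (x : ℝ) : ℝ :=
  ((2 + σ) / (1 - p) * (1 - (2 + σ) / (1 - p))) ^ (1 / (p - 1)) * x ^ ((2 + σ) / (1 - p))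

/-- `u` is a positive `C²` solution of `-u'' = x^σ u^p` on `(0,+∞)`. -/
def IsPosSol (p σ : ℝ) (u : ℝ → ℝ) : Prop :=
  (∀ x ∈ Set.Ioi (0 : ℝ), 0 < u x) ∧ ContDiffOn ℝ 2 u (Set.Ioi 0) ∧
  ∀ x ∈ Set.Ioi (0 : ℝ), -(deriv (deriv u) x) = x ^ σ * u x ^ p

open Filter Topology

/-- A concave function on `(0,+∞)` with a sublinear lower bound is nondecreasing. -/
lemma ConcaveOn.monotoneOn_of_sublinear_lower_bound {h : ℝ → ℝ} {C a : ℝ}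
    (hh : ConcaveOn ℝ (Ioi 0) h) (ha : a < 1) (hb : ∀ x, 0 < x → -C * x ^ a ≤ h x) :
    MonotoneOn h (Ioi 0) := by
  intro x hx y hy hxy
  rcases hxy.eq_or_lt with rfl | hxy
  · exact le_rfl
  rw [mem_Ioi] at hx hy
  set m := (h y - h x) / (y - x) with hm
  have key : ∀ z, y < z → 0 ≤ (h y - m * y) * z⁻¹ + C * z ^ (-(1 - a)) + m := by
    intro z hz
    have hz0 : 0 < z := hy.trans hz
    have h1 := hh.slope_anti_adjacent hx hz0 hxy hz
    rw [← hm, div_le_iff₀ (sub_pos.2 hz)] at h1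
    have h2 := hb z hz0
    have h3 : z ^ (-(1 - a)) = z ^ a * z⁻¹ := by
      rw [← Real.rpow_neg_one, ← Real.rpow_add hz0]; ring_nf
    have h4 : 0 ≤ (h y - m * y + C * z ^ a + m * z) * z⁻¹ :=
      mul_nonneg (by linarith) (inv_nonneg.2 hz0.le)
    calc (0 : ℝ) ≤ _ := h4
      _ = _ := by rw [h3]; field_simp
  have lim : Tendsto (fun z : ℝ => (h y - m * y) * z⁻¹ + C * z ^ (-(1 - a)) + m) atTop
      (𝓝 ((h y - m * y) * 0 + C * 0 + m)) :=
    ((tendsto_inv_atTop_zero.const_mul _).add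
      ((tendsto_rpow_neg_atTop (sub_pos.2 ha)).const_mul _)).add_const _
  have hm0 : 0 ≤ m := by
    simpa using ge_of_tendsto lim ((eventually_gt_atTop y).mono key)
  by_contra! hlt
  exact absurd hm0 (not_le.2 (div_neg_of_neg_of_pos (by linarith) (by linarith)))

/-- A nondecreasing function on `(0,+∞)` bounded below by `-C x ^ b`, `b > 0`, is nonnegative. -/
lemma MonotoneOn.nonneg_of_rpow_lower_bound {h : ℝ → ℝ} {C b : ℝ}
    (hh : MonotoneOn h (Ioi 0)) (hb0 : 0 < b) (hb : ∀ x, 0 < x → -C * x ^ b ≤ h x)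
    {x : ℝ} (hx : 0 < x) : 0 ≤ h x := by
  have lim : Tendsto (fun y : ℝ => -C * y ^ b) (𝓝[>] 0) (𝓝 (-C * 0 ^ b)) :=
    ((Real.continuousAt_rpow_const 0 b (Or.inr hb0.le)).tendsto.const_mul _).mono_left
      nhdsWithin_le_nhds
  rw [Real.zero_rpow hb0.ne', mul_zero] at lim
  refine le_of_tendsto lim ?_
  filter_upwards [Ioc_mem_nhdsGT hx] with y hy
  exact (hb y hy.1).trans (hh hy.1 hx hy.2)

/-- On `(0,+∞)`, a nonpositive second derivative gives concavity. -/
lemma concaveOn_Ioi_of_hasDerivAt2_nonpos {f f' f'' : ℝ → ℝ}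
    (h1 : ∀ x, 0 < x → HasDerivAt f (f' x) x) (h2 : ∀ x, 0 < x → HasDerivAt f' (f'' x) x)
    (h3 : ∀ x, 0 < x → f'' x ≤ 0) : ConcaveOn ℝ (Ioi 0) f := by
  refine concaveOn_of_hasDerivWithinAt2_nonpos (f' := f') (f'' := f'') (convex_Ioi 0)
    (fun x hx => (h1 x hx).continuousAt.continuousWithinAt) ?_ ?_ ?_ <;>
  · rw [interior_Ioi]
    intro x hx
    first
    | exact (h1 x hx).hasDerivWithinAt
    | exact (h2 x hx).hasDerivWithinAt
    | exact h3 x hx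

namespace IsPosSol

variable {p σ : ℝ} {u : ℝ → ℝ}

lemma hasDerivAt (hu : IsPosSol p σ u) {x : ℝ} (hx : 0 < x) : HasDerivAt u (deriv u x) x :=
  ((hu.2.1.contDiffAt (Ioi_mem_nhds hx)).differentiableAt (by norm_num)).hasDerivAt

lemma hasDerivAt_deriv (hu : IsPosSol p σ u) {x : ℝ} (hx : 0 < x) :
    HasDerivAt (deriv u) (-(x ^ σ * u x ^ p)) x := by
  have h1 : ContDiffOn ℝ 1 (deriv u) (Ioi 0) :=
    ((contDiffOn_succ_iff_deriv_of_isOpen (n := 1) isOpen_Ioi).1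
      (by simpa [one_add_one_eq_two] using hu.2.1)).2.2
  rw [← hu.2.2 x hx, neg_neg]
  exact ((h1.contDiffAt (Ioi_mem_nhds hx)).differentiableAt (by norm_num)).hasDerivAt

lemma monotoneOn (hu : IsPosSol p σ u) : MonotoneOn u (Ioi 0) := by
  refine ConcaveOn.monotoneOn_of_sublinear_lower_bound (C := 0) (a := 0)
    (concaveOn_Ioi_of_hasDerivAt2_nonpos (fun x => hu.hasDerivAt) (fun x => hu.hasDerivAt_deriv)
      fun x hx => ?_) zero_lt_one fun x hx => by simpa using (hu.1 x hx).le
  have := Real.rpow_nonneg hx.le σ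
  have := Real.rpow_nonneg (hu.1 x hx).le p
  rw [neg_nonpos]; positivity

lemma deriv_nonneg (hu : IsPosSol p σ u) {x : ℝ} (hx : 0 < x) : 0 ≤ deriv u x := by
  rw [← derivWithin_of_isOpen isOpen_Ioi hx]
  exact hu.monotoneOn.derivWithin_nonneg

lemma le_deriv (hu : IsPosSol p σ u) (hp : 0 ≤ p) {x : ℝ} (hx : 0 < x) :
    min 1 (2 ^ σ) * x ^ (σ + 1) * u x ^ p ≤ deriv u x := by
  have pos : ∀ y ∈ Icc x (2 * x), 0 < y := fun y hy => hx.trans_le hy.1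
  obtain ⟨y, hy, hslope⟩ := exists_hasDerivAt_eq_slope (deriv u)
    (fun y => -(y ^ σ * u y ^ p)) (show x < 2 * x by linarith)
    (fun y hy => (hu.hasDerivAt_deriv (pos y hy)).continuousAt.continuousWithinAt)
    (fun y hy => hu.hasDerivAt_deriv (pos y (Ioo_subset_Icc_self hy)))
  have hy0 : 0 < y := hx.trans hy.1
  have hpow : min 1 (2 ^ σ) * x ^ σ ≤ y ^ σ := by
    have hxσ := Real.rpow_nonneg hx.le σ
    rcases le_total 0 σ with h | h
    · calc min 1 (2 ^ σ) * x ^ σ ≤ 1 * x ^ σ := by gcongr; exact min_le_left _ _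
        _ ≤ y ^ σ := by rw [one_mul]; exact Real.rpow_le_rpow hx.le hy.1.le h
    · calc min 1 (2 ^ σ) * x ^ σ ≤ 2 ^ σ * x ^ σ := by gcongr; exact min_le_right _ _
        _ = (2 * x) ^ σ := (Real.mul_rpow two_pos.le hx.le).symm
        _ ≤ y ^ σ := Real.rpow_le_rpow_of_nonpos hy0 hy.2.le h
  have hup : u x ^ p ≤ u y ^ p :=
    Real.rpow_le_rpow (hu.1 x hx).le (hu.monotoneOn hx hy0 hy.1.le) hp
  have hd := hu.deriv_nonneg (show 0 < 2 * x by linarith)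
  rw [eq_div_iff (by linarith)] at hslope
  have hmul : min 1 (2 ^ σ) * x ^ σ * u x ^ p ≤ y ^ σ * u y ^ p :=
    mul_le_mul hpow hup (Real.rpow_nonneg (hu.1 x hx).le p) (Real.rpow_nonneg hy0.le σ)
  have := mul_le_mul_of_nonneg_right hmul hx.le
  rw [Real.rpow_add_one hx.ne']
  nlinarith

/-- For `0 ≤ p < 1`, every positive solution is bounded below by a multiple of `x ^ a`. -/
lemma exists_mul_rpow_le (hu : IsPosSol p σ u) (hσ : -2 < σ) (hp : 0 ≤ p) (hp1 : p < 1) :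
    ∃ ε > 0, ∀ x, 0 < x → ε * x ^ ((2 + σ) / (1 - p)) ≤ u x := by
  have hm : 0 < min (1 : ℝ) (2 ^ σ) := lt_min one_pos (Real.rpow_pos_of_pos two_pos σ)
  set K := (1 - p) * min (1 : ℝ) (2 ^ σ) / (2 + σ)
  have hp1' : 0 < 1 - p := by linarith
  have hσ' : 0 < 2 + σ := by linarith
  have hK : 0 < K := by positivity
  have hder : ∀ x, 0 < x → HasDerivAt (fun x => u x ^ (1 - p) - K * x ^ (2 + σ))
      (deriv u x * (1 - p) * u x ^ (1 - p - 1) - K * ((2 + σ) * x ^ (2 + σ - 1))) x :=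
    fun x hx => ((hu.hasDerivAt hx).rpow_const (Or.inl (hu.1 x hx).ne')).sub
      ((Real.hasDerivAt_rpow_const (Or.inl hx.ne')).const_mul K)
  have hmono : MonotoneOn (fun x => u x ^ (1 - p) - K * x ^ (2 + σ)) (Ioi 0) := by
    refine monotoneOn_of_deriv_nonneg (convex_Ioi 0)
      (fun x hx => (hder x hx).continuousAt.continuousWithinAt)
      (fun x hx => ?_) (fun x hx => ?_) <;> rw [interior_Ioi] at hx
    · exact (hder x hx).differentiableAt.differentiableWithinAt
    · rw [(hder x hx).deriv, sub_nonneg]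
      have hux := hu.1 x hx
      have h1 : u x ^ p * u x ^ (1 - p - 1) = 1 := by
        rw [← Real.rpow_add hux]; simp
      calc K * ((2 + σ) * x ^ (2 + σ - 1))
          = (min 1 (2 ^ σ) * x ^ (σ + 1) * u x ^ p) * (1 - p) * u x ^ (1 - p - 1) := by
            have h2 : K * (2 + σ) = (1 - p) * min 1 (2 ^ σ) := div_mul_cancel₀ _ hσ'.ne'
            rw [show 2 + σ - 1 = σ + 1 by ring]
            linear_combination x ^ (σ + 1) * h2 - x ^ (σ + 1) * min 1 (2 ^ σ) * (1 - p) * h1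
        _ ≤ _ := by
            have := Real.rpow_nonneg hux.le (1 - p - 1)
            gcongr
            exact hu.le_deriv hp hx
  refine ⟨K ^ (1 / (1 - p)), Real.rpow_pos_of_pos hK _, fun x hx => ?_⟩
  have h0 := hmono.nonneg_of_rpow_lower_bound (C := K) hσ' (fun y hy => by
    have := Real.rpow_nonneg (hu.1 y hy).le (1 - p)
    linarith) hx
  have hxσ := Real.rpow_pos_of_pos hx (2 + σ)
  calc K ^ (1 / (1 - p)) * x ^ ((2 + σ) / (1 - p))
      = (K * x ^ (2 + σ)) ^ (1 / (1 - p)) := by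
        rw [Real.mul_rpow hK.le hxσ.le, ← Real.rpow_mul hx.le, mul_one_div]
    _ ≤ (u x ^ (1 - p)) ^ (1 / (1 - p)) :=
        Real.rpow_le_rpow (by positivity) (by linarith) (by positivity)
    _ = u x := by
        rw [← Real.rpow_mul (hu.1 x hx).le, mul_one_div_cancel hp1'.ne', Real.rpow_one]

end IsPosSol

section Explicit

variable {p σ : ℝ}

lemma explicitExponent_mem_Ioo (hσ : -2 < σ) (hp : p < -1 - σ) :
    (2 + σ) / (1 - p) ∈ Ioo (0 : ℝ) 1 :=
  ⟨div_pos (by linarith) (by linarith), (div_lt_one (by linarith)).2 (by linarith)⟩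

lemma explicitCoeff_pos (hσ : -2 < σ) (hp : p < -1 - σ) :
    0 < ((2 + σ) / (1 - p) * (1 - (2 + σ) / (1 - p))) ^ (1 / (p - 1)) := by
  have ha := explicitExponent_mem_Ioo hσ hp
  exact Real.rpow_pos_of_pos (mul_pos ha.1 (sub_pos.2 ha.2)) _

lemma uExplicit_pos (hσ : -2 < σ) (hp : p < -1 - σ) {x : ℝ} (hx : 0 < x) :
    0 < uExplicit p σ x :=
  mul_pos (explicitCoeff_pos hσ hp) (Real.rpow_pos_of_pos hx _)

lemma explicit_second_deriv (hσ : -2 < σ) (hp : p < -1 - σ) {x : ℝ} (hx : 0 < x) :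
    ((2 + σ) / (1 - p) * (1 - (2 + σ) / (1 - p))) ^ (1 / (p - 1)) *
      ((2 + σ) / (1 - p) * (((2 + σ) / (1 - p) - 1) * x ^ ((2 + σ) / (1 - p) - 1 - 1))) =
      -(x ^ σ * uExplicit p σ x ^ p) := by
  have ha := explicitExponent_mem_Ioo hσ hp
  have hc := explicitCoeff_pos hσ hp
  have hp1 : 1 - p ≠ 0 := by linarith
  have hap : (2 + σ) / (1 - p) - 1 - 1 = σ + (2 + σ) / (1 - p) * p := by field_simp; ring
  have hB : 0 < (2 + σ) / (1 - p) * (1 - (2 + σ) / (1 - p)) :=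
    mul_pos ha.1 (sub_pos.2 ha.2)
  unfold uExplicit
  rw [hap]
  set a := (2 + σ) / (1 - p)
  set c := (a * (1 - a)) ^ (1 / (p - 1)) with hcdef
  have hcp : c ^ p = c * (a * (1 - a)) := by
    have : c ^ (p - 1) = a * (1 - a) := by
      rw [hcdef, ← Real.rpow_mul hB.le, one_div_mul_cancel (by linarith), Real.rpow_one]
    rw [← this, mul_comm, ← Real.rpow_add_one hc.ne', sub_add_cancel]
  rw [Real.mul_rpow hc.le (Real.rpow_nonneg hx.le a), ← Real.rpow_mul hx.le, hcp,
    Real.rpow_add hx]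
  ring

/-- If `k u_a^p ≤ u^p` on `(0,+∞)`, then the solution `u` lies above `k u_a`. -/
lemma IsPosSol.mul_uExplicit_le {u : ℝ → ℝ} {k : ℝ} (hu : IsPosSol p σ u) (hσ : -2 < σ)
    (hp : p < -1 - σ) (hk : ∀ x, 0 < x → k * uExplicit p σ x ^ p ≤ u x ^ p)
    {x : ℝ} (hx : 0 < x) : k * uExplicit p σ x ≤ u x := by
  have ha := explicitExponent_mem_Ioo hσ hp
  set a := (2 + σ) / (1 - p)
  set c := (a * (1 - a)) ^ (1 / (p - 1))
  have hd1 : ∀ x, 0 < x → HasDerivAt (fun x => u x - k * (c * x ^ a))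
      (deriv u x - k * (c * (a * x ^ (a - 1)))) x := fun x hx =>
    (hu.hasDerivAt hx).sub
      (((Real.hasDerivAt_rpow_const (Or.inl hx.ne')).const_mul c).const_mul k)
  have hd2 : ∀ x, 0 < x → HasDerivAt (fun x => deriv u x - k * (c * (a * x ^ (a - 1))))
      (-(x ^ σ * u x ^ p) - k * (c * (a * ((a - 1) * x ^ (a - 1 - 1))))) x := fun x hx =>
    (hu.hasDerivAt_deriv hx).sub
      ((((Real.hasDerivAt_rpow_const (Or.inl hx.ne')).const_mul a).const_mul c).const_mul k)
  have hconc := concaveOn_Ioi_of_hasDerivAt2_nonpos hd1 hd2 fun x hx => by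
    rw [explicit_second_deriv hσ hp hx]
    have := mul_le_mul_of_nonneg_left (hk x hx) (Real.rpow_nonneg hx.le σ)
    linarith
  have hlow : ∀ x, 0 < x → -(k * c) * x ^ a ≤ u x - k * (c * x ^ a) := fun x hx => by
    have := hu.1 x hx
    linarith
  have := (hconc.monotoneOn_of_sublinear_lower_bound ha.2 hlow).nonneg_of_rpow_lower_bound
    ha.1 hlow hx
  exact sub_nonneg.1 this

end Explicit

/-- **Theorem 5.8.** For `σ > -2` and `p < -1-σ`, no global positive solution of
`-u'' = x^σ u^p` on `(0,+∞)` stays strictly below the explicit solution `u_a`. -/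
theorem no_solution_strictly_below_explicit (p σ : ℝ) (hσ : -2 < σ) (hp : p < -1 - σ) :
    ¬ ∃ u : ℝ → ℝ, IsPosSol p σ u ∧ ∀ x ∈ Set.Ioi (0 : ℝ), u x < uExplicit p σ x := by
  rintro ⟨u, hu, hlt⟩
  have hp1 : p < 1 := by linarith
  have hpos : ∀ x, 0 < x → 0 < uExplicit p σ x := fun x hx => uExplicit_pos hσ hp hx
  rcases le_or_gt 0 p with hp0 | hp0
  · set S := (fun x => u x / uExplicit p σ x) '' Ioi 0
    have hS : S.Nonempty := nonempty_Ioi.image _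
    obtain ⟨ε, hε, hεu⟩ := hu.exists_mul_rpow_le hσ hp0 hp1
    have hc := explicitCoeff_pos hσ hp
    have hbdd : BddBelow S := ⟨0, by
      rintro _ ⟨x, hx, rfl⟩
      exact (div_pos (hu.1 x hx) (hpos x hx)).le⟩
    have he_pos : 0 < sInf S := by
      refine (div_pos hε hc).trans_le (le_csInf hS ?_)
      rintro _ ⟨x, hx, rfl⟩
      have hxa := Real.rpow_pos_of_pos hx ((2 + σ) / (1 - p))
      calc _ = ε * x ^ ((2 + σ) / (1 - p)) / uExplicit p σ x := by
            rw [uExplicit, mul_div_mul_right _ _ hxa.ne']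
        _ ≤ _ := div_le_div_of_nonneg_right (hεu x hx) (hpos x hx).le
    have he_le : ∀ x, 0 < x → sInf S ≤ u x / uExplicit p σ x := fun x hx =>
      csInf_le hbdd (mem_image_of_mem _ hx)
    have he_lt : sInf S < 1 :=
      (he_le 1 one_pos).trans_lt ((div_lt_one (hpos 1 one_pos)).2 (hlt 1 (mem_Ioi.2 one_pos)))
    have hself : sInf S ^ p ≤ sInf S := by
      refine le_csInf hS ?_
      rintro _ ⟨x, hx, rfl⟩
      refine (le_div_iff₀ (hpos x hx)).2 (hu.mul_uExplicit_le hσ hp (fun y hy => ?_) hx)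
      rw [← Real.mul_rpow he_pos.le (hpos y hy).le]
      exact Real.rpow_le_rpow (mul_pos he_pos (hpos y hy)).le
        ((le_div_iff₀ (hpos y hy)).1 (he_le y hy)) hp0
    have := Real.rpow_lt_rpow_of_exponent_gt he_pos he_lt hp1
    rw [Real.rpow_one] at this
    linarith
  · have h := hu.mul_uExplicit_le (k := 1) hσ hp (fun x hx => by
      rw [one_mul]
      exact Real.rpow_le_rpow_of_nonpos (hu.1 x hx) (hlt x hx).le hp0.le) one_pos
    rw [one_mul] at h
    exact absurd (hlt 1 (mem_Ioi.2 one_pos)) (not_lt.2 h)
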